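/- Let B be a 4×4 real skew-symmetric matrix, let c ∈ ℝ⁴, and let η : ℝ⁴ → ℝ⁴ be the affine map η(x) = Bx + c. Then η ∈ T(Σ) (that is, π(η(x))·π(x) = 0 for all x ∈ Σ) if and only if the fourth row and fourth column of B are zero (so that B = [[B̃, 0],[0, 0]] for a 3×3 real skew-symmetric matrix B̃) and π(c) = 0. -/

import Mathlib

open Matrix

/-- The hypercylinder Σ in ℝ⁴. -/
def Hyp : Set (Fin 4 → ℝ) := {x | x 0 ^ 2 + x 1 ^ 2 + x 2 ^ 2 = 1}

/-- The Euclidean inner product of the projections onto the first three coordinates,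
i.e. π(x)·π(y). -/
def piDot (x y : Fin 4 → ℝ) : ℝ := x 0 * y 0 + x 1 * y 1 + x 2 * y 2

theorem stmt0 (B : Matrix (Fin 4) (Fin 4) ℝ) (hB : Bᵀ = -B) (c : Fin 4 → ℝ) :
    (∀ x ∈ Hyp, piDot (B.mulVec x + c) x = 0) ↔
      ((∀ i, B 3 i = 0 ∧ B i 3 = 0) ∧ c 0 = 0 ∧ c 1 = 0 ∧ c 2 = 0) := by
  have hskew : ∀ i j, B j i = -B i j := fun i j => congrFun (congrFun hB i) j
  have hdiag : ∀ i, B i i = 0 := fun i => by linarith [hskew i i]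
  constructor
  · intro h
    have h0 := h ![1, 0, 0, 0] (by simp [Hyp])
    have h1 := h ![0, 1, 0, 0] (by simp [Hyp])
    have h2 := h ![0, 0, 1, 0] (by simp [Hyp])
    have k0 := h ![1, 0, 0, 1] (by simp [Hyp])
    have k1 := h ![0, 1, 0, 1] (by simp [Hyp])
    have k2 := h ![0, 0, 1, 1] (by simp [Hyp])
    simp [piDot, mulVec, dotProduct, Fin.sum_univ_four, hdiag] at h0 h1 h2 k0 k1 k2
    have hcol : ∀ i, B i 3 = 0 := by
      intro i
      fin_cases i
      · simpa [h0] using k0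
      · simpa [h1] using k1
      · simpa [h2] using k2
      · exact hdiag 3
    exact ⟨fun i => ⟨by rw [hskew i 3, hcol, neg_zero], hcol i⟩, h0, h1, h2⟩
  · rintro ⟨h, h0, h1, h2⟩ x -
    simp only [piDot, mulVec, dotProduct, Fin.sum_univ_four, Pi.add_apply, hdiag, h, h0, h1, h2,
      hskew 0 1, hskew 0 2, hskew 1 2]
    ring
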